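/- arXiv:2202.13254 — 4 statements merged into one kernel-verified Lean document; each statement's English description precedes it below -/
import Mathlib

section
/- Let E_D be an invertible n₁×n₁ real matrix, A₄ an invertible n₂×n₂ real matrix, and A₁ ∈ ℝ^{n₁×n₁}, A₂ ∈ ℝ^{n₁×n₂}, A₃ ∈ ℝ^{n₂×n₁} arbitrary. Define the (n₁+n₂)×(n₁+n₂) block matrices E = [[E_D, 0],[0, 0]] and A = [[A₁, A₂],[A₃, A₄]]. Then there exists s ∈ ℝ such that det(s·E − A) ≠ 0 (i.e., the matrix pencil (E, A) is regular). -/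
/-- A matrix pencil with invertible leading coefficient over an infinite field is regular. -/
theorem Matrix.exists_det_smul_sub_ne_zero {n K : Type*} [Fintype n] [DecidableEq n]
    [Field K] [Infinite K] {E : Matrix n n K} (hE : IsUnit E) (S : Matrix n n K) :
    ∃ s : K, (s • E - S).det ≠ 0 := by
  have hdet : IsUnit E.det := (Matrix.isUnit_iff_isUnit_det E).1 hE
  obtain ⟨s, hs⟩ := Polynomial.exists_eval_ne_zero_of_natDegree_lt_card _
    (E⁻¹ * S).charpoly_monic.ne_zero
    (Cardinal.natCast_lt_aleph0.trans_le (Cardinal.aleph0_le_mk K))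
  refine ⟨s, ?_⟩
  have hfactor : s • E - S = E * (Matrix.scalar n s - E⁻¹ * S) := by
    rw [mul_sub, Matrix.mul_nonsing_inv_cancel_left _ _ hdet, Matrix.scalar_apply,
      ← Matrix.smul_one_eq_diagonal, Matrix.mul_smul, mul_one]
  rw [hfactor, Matrix.det_mul, ← Matrix.eval_charpoly]
  exact mul_ne_zero hdet.ne_zero hs


open Matrix

/-- Regularity of the power-network DAE pencil (Theorem 1, regularity part):
if `E_D` and `A₄` are invertible, then the pencil `(E, A)` with
`E = [[E_D,0],[0,0]]` and `A = [[A₁,A₂],[A₃,A₄]]` is regular, i.e. there is a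
scalar `s` with `det (s • E - A) ≠ 0`. -/
theorem stmt_0 {n₁ n₂ : ℕ}
    (E_D A₁ : Matrix (Fin n₁) (Fin n₁) ℝ)
    (A₂ : Matrix (Fin n₁) (Fin n₂) ℝ)
    (A₃ : Matrix (Fin n₂) (Fin n₁) ℝ)
    (A₄ : Matrix (Fin n₂) (Fin n₂) ℝ)
    (hED : IsUnit E_D) (hA₄ : IsUnit A₄) :
    ∃ s : ℝ,
      (s • (fromBlocks E_D 0 0 0 : Matrix (Fin n₁ ⊕ Fin n₂) (Fin n₁ ⊕ Fin n₂) ℝ)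
        - fromBlocks A₁ A₂ A₃ A₄).det ≠ 0 := by
  have hneg : IsUnit (-A₄) := hA₄.neg
  let _ : Invertible (-A₄) := hneg.invertible
  obtain ⟨s, hs⟩ := Matrix.exists_det_smul_sub_ne_zero hED (A₁ + A₂ * ⅟(-A₄) * A₃)
  refine ⟨s, ?_⟩
  have hblocks : s • fromBlocks E_D 0 0 0 - fromBlocks A₁ A₂ A₃ A₄
      = fromBlocks (s • E_D - A₁) (-A₂) (-A₃) (-A₄) := by
    simp [fromBlocks_smul, sub_eq_add_neg, fromBlocks_neg, fromBlocks_add]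
  rw [hblocks, det_fromBlocks₂₂]
  refine mul_ne_zero ((Matrix.isUnit_iff_isUnit_det _).1 hneg).ne_zero ?_
  rwa [Matrix.neg_mul, Matrix.neg_mul, Matrix.mul_neg, neg_neg, sub_sub]
end

section
/- Let E_D be an invertible n₁×n₁ real matrix, A₄ an invertible n₂×n₂ real matrix, and A₁ ∈ ℝ^{n₁×n₁}, A₂ ∈ ℝ^{n₁×n₂}, A₃ ∈ ℝ^{n₂×n₁} arbitrary. Define the block matrices E = [[E_D, 0],[0, 0]] and A = [[A₁, A₂],[A₃, A₄]]. Then the polynomial p(X) = det(X·(E mapped into ℝ[X] via C) − (A mapped into ℝ[X] via C)) has degree exactly n₁, i.e., Polynomial.degree p = n₁ = rank E. -/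
open Matrix Polynomial

/-- The degree of `det (X • A + B)` is the size of the matrices when `det A ≠ 0`. -/
theorem degree_det_X_smul_map_add_map {n R : Type*} [DecidableEq n] [Fintype n] [CommRing R]
    (A B : Matrix n n R) (hA : A.det ≠ 0) :
    ((X : R[X]) • A.map C + B.map C).det.degree = Fintype.card n := by
  refine le_antisymm (degree_le_of_natDegree_le (natDegree_det_X_add_C_le A B)) ?_
  exact le_degree_of_ne_zero (by rwa [coeff_det_X_add_C_card])

/-- Elimination of the algebraic variables in a semi-explicit matrix pencil. -/
theorem det_pencil_fromBlocks_eq_C_mul_det_schur {m n R : Type*} [DecidableEq m] [Fintype m]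
    [DecidableEq n] [Fintype n] [CommRing R] (E A₁ : Matrix m m R) (A₂ : Matrix m n R)
    (A₃ : Matrix n m R) (A₄ : Matrix n n R) (hA₄ : IsUnit A₄) :
    ((X : R[X]) • (fromBlocks E 0 0 0 : Matrix (m ⊕ n) (m ⊕ n) R).map C
        - (fromBlocks A₁ A₂ A₃ A₄).map C).det =
      C (-A₄).det * ((X : R[X]) • E.map C + (A₂ * A₄⁻¹ * A₃ - A₁).map C).det := by
  have hinv : (-A₄).map (C : R →+* R[X]) * (-A₄⁻¹).map C = 1 := by
    rw [← Matrix.map_mul, neg_mul_neg, mul_nonsing_inv _ ((isUnit_iff_isUnit_det _).1 hA₄)]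
    simp
  let _ := invertibleOfRightInverse _ _ hinv
  have hblocks : (X : R[X]) • (fromBlocks E 0 0 0 : Matrix (m ⊕ n) (m ⊕ n) R).map C
        - (fromBlocks A₁ A₂ A₃ A₄).map C =
      fromBlocks ((X : R[X]) • E.map C - A₁.map C) ((-A₂).map C) ((-A₃).map C)
        ((-A₄).map C) := by
    ext (i | i) (j | j) <;> simp
  have hschur : (-A₂).map (C : R →+* R[X]) * (-A₄⁻¹).map C * (-A₃).map C =
      -(A₂ * A₄⁻¹ * A₃).map C := by
    rw [← Matrix.map_mul, ← Matrix.map_mul, ← Matrix.map_neg _ (map_neg C)]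
    simp only [Matrix.neg_mul, Matrix.mul_neg, neg_neg]
  have hC : ((-A₄).map (C : R →+* R[X])).det = C (-A₄).det := (RingHom.map_det C _).symm
  rw [hblocks, det_fromBlocks₂₂, hC, invOf_eq_right_inv hinv, hschur,
    Matrix.map_sub _ (map_sub C)]
  congr 2
  abel

/-- Impulse-freeness / index-one of the power-network DAE (Theorem 1, degree part):
if `E_D` and `A₄` are invertible, the pencil polynomial
`det (X • E.map C - A.map C)` has degree exactly `n₁ = rank E`. -/
theorem stmt_1 {n₁ n₂ : ℕ}
    (E_D A₁ : Matrix (Fin n₁) (Fin n₁) ℝ)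
    (A₂ : Matrix (Fin n₁) (Fin n₂) ℝ)
    (A₃ : Matrix (Fin n₂) (Fin n₁) ℝ)
    (A₄ : Matrix (Fin n₂) (Fin n₂) ℝ)
    (hED : IsUnit E_D) (hA₄ : IsUnit A₄) :
    Polynomial.degree
      (((Polynomial.X : Polynomial ℝ) •
          (fromBlocks E_D 0 0 0 : Matrix (Fin n₁ ⊕ Fin n₂) (Fin n₁ ⊕ Fin n₂) ℝ).map
            Polynomial.C
        - (fromBlocks A₁ A₂ A₃ A₄).map Polynomial.C).det) = n₁ := by
  have hdet : (-A₄).det ≠ 0 := ((isUnit_iff_isUnit_det _).1 hA₄.neg).ne_zero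
  rw [det_pencil_fromBlocks_eq_C_mul_det_schur _ _ _ _ _ hA₄, degree_C_mul hdet,
    degree_det_X_smul_map_add_map _ _ ((isUnit_iff_isUnit_det _).1 hED).ne_zero, Fintype.card_fin]
end

section
/- Let A, E, X, Γ be n×n real matrices with X symmetric, C a p×n real matrix, E⊥ and Y (n−r)×n real matrices, W an n×p real matrix, B_w an n×q real matrix, D_w a p×q real matrix, and γ > 0. Suppose P := X·E + E⊥ᵀ·Y is invertible and set L := (W·P⁻¹)ᵀ. Define Ξ := Aᵀ·E⊥ᵀ·Y + Yᵀ·E⊥·A − Cᵀ·W − Wᵀ·C, and suppose the symmetric (n+q)×(n+q) block matrix M = [[Aᵀ·X·E + Eᵀ·X·A + Ξ + Γᵀ·Γ, (B_wᵀ·X·E + B_wᵀ·E⊥ᵀ·Y − D_wᵀ·W)ᵀ],[B_wᵀ·X·E + B_wᵀ·E⊥ᵀ·Y − D_wᵀ·W, −γ·1]] is negative definite. Then for all e ∈ ℝⁿ and w ∈ ℝ^q with (e, w) ≠ (0, 0), the dissipation inequality eᵀ·((A − L·C)ᵀ·P + Pᵀ·(A − L·C))·e + 2·eᵀ·Pᵀ·(B_w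 − L·D_w)·w + ‖Γ·e‖² − γ·‖w‖² < 0 holds. -/
open Matrix

/-- A real square matrix is negative definite: `vᵀ M v < 0` for every nonzero `v`. -/
def negDef {m : Type*} [Fintype m] (M : Matrix m m ℝ) : Prop :=
  ∀ v : m → ℝ, v ≠ 0 → v ⬝ᵥ M.mulVec v < 0

/-- The quadratic form of a block matrix with off-diagonal blocks `Kᵀ` and `K`. -/
theorem dotProduct_fromBlocks_transpose_mulVec {m k R : Type*} [Fintype m] [Fintype k]
    [CommRing R] (Q : Matrix m m R) (K : Matrix k m R) (S : Matrix k k R)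
    (e : m → R) (w : k → R) :
    Sum.elim e w ⬝ᵥ (fromBlocks Q Kᵀ K S).mulVec (Sum.elim e w) =
      e ⬝ᵥ Q.mulVec e + 2 * (e ⬝ᵥ Kᵀ.mulVec w) + w ⬝ᵥ S.mulVec w := by
  have hK : w ⬝ᵥ K.mulVec e = e ⬝ᵥ Kᵀ.mulVec w := by
    rw [dotProduct_mulVec, mulVec_transpose, dotProduct_comm]
  rw [fromBlocks_mulVec, sumElim_dotProduct_sumElim]
  simp only [Sum.elim_comp_inl, Sum.elim_comp_inr, dotProduct_add, hK]
  ring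

/-- Key step of Theorem 4 (Appendix E): feasibility of the H∞ LMI (16) with
`P = X E + E⊥ᵀ Y` and `L = (W P⁻¹)ᵀ` yields the strict dissipation inequality
`eᵀ((A-LC)ᵀP + Pᵀ(A-LC))e + 2 eᵀ Pᵀ (B_w - L D_w) w + ‖Γe‖² - γ‖w‖² < 0`
for all `(e, w) ≠ (0, 0)`. -/
theorem stmt_10 {n p q r : ℕ}
    (A E X Γ : Matrix (Fin n) (Fin n) ℝ) (hX : Xᵀ = X)
    (C : Matrix (Fin p) (Fin n) ℝ)
    (Eperp Y : Matrix (Fin (n - r)) (Fin n) ℝ)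
    (W : Matrix (Fin p) (Fin n) ℝ)
    (B_w : Matrix (Fin n) (Fin q) ℝ)
    (D_w : Matrix (Fin p) (Fin q) ℝ)
    (γ : ℝ) (hγ : 0 < γ)
    (P : Matrix (Fin n) (Fin n) ℝ) (hP : P = X * E + Eperpᵀ * Y)
    (hPinv : IsUnit P)
    (L : Matrix (Fin n) (Fin p) ℝ) (hL : L = (W * P⁻¹)ᵀ)
    (hM : negDef (fromBlocks
        (Aᵀ * X * E + Eᵀ * X * A
          + (Aᵀ * Eperpᵀ * Y + Yᵀ * Eperp * A - Cᵀ * W - Wᵀ * C) + Γᵀ * Γ)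
        (B_wᵀ * X * E + B_wᵀ * Eperpᵀ * Y - D_wᵀ * W)ᵀ
        (B_wᵀ * X * E + B_wᵀ * Eperpᵀ * Y - D_wᵀ * W)
        (-(γ • (1 : Matrix (Fin q) (Fin q) ℝ))))) :
    ∀ (e : Fin n → ℝ) (w : Fin q → ℝ), ¬(e = 0 ∧ w = 0) →
      e ⬝ᵥ (((A - L * C)ᵀ * P + Pᵀ * (A - L * C)).mulVec e)
        + 2 * (e ⬝ᵥ ((Pᵀ * (B_w - L * D_w)).mulVec w))
        + (Γ.mulVec e) ⬝ᵥ (Γ.mulVec e)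
        - γ * (w ⬝ᵥ w) < 0 := by
  intro e w hew
  have hv : Sum.elim e w ≠ 0 := fun h =>
    hew ⟨funext fun i => congrFun h (Sum.inl i), funext fun j => congrFun h (Sum.inr j)⟩
  have hLP : Lᵀ * P = W := by
    rw [hL, transpose_transpose, Matrix.mul_assoc,
      nonsing_inv_mul P ((isUnit_iff_isUnit_det P).mp hPinv), Matrix.mul_one]
  have hPL : Pᵀ * L = Wᵀ := by
    rw [← hLP, transpose_mul, transpose_transpose]
  have hPt : Pᵀ = Eᵀ * X + Yᵀ * Eperp := by
    rw [hP, transpose_add, transpose_mul, transpose_mul, transpose_transpose, hX]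
  have hdiag : Aᵀ * X * E + Eᵀ * X * A
        + (Aᵀ * Eperpᵀ * Y + Yᵀ * Eperp * A - Cᵀ * W - Wᵀ * C) + Γᵀ * Γ
      = (A - L * C)ᵀ * P + Pᵀ * (A - L * C) + Γᵀ * Γ := by
    rw [transpose_sub, transpose_mul, Matrix.sub_mul, Matrix.mul_sub, Matrix.mul_assoc Cᵀ, hLP,
      ← Matrix.mul_assoc Pᵀ, hPL, hPt, hP]
    simp only [Matrix.mul_add, Matrix.add_mul, Matrix.mul_assoc]
    abel
  have hoff : (B_wᵀ * X * E + B_wᵀ * Eperpᵀ * Y - D_wᵀ * W)ᵀ = Pᵀ * (B_w - L * D_w) := by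
    rw [Matrix.mul_sub, ← Matrix.mul_assoc Pᵀ, hPL, Matrix.mul_assoc B_wᵀ,
      Matrix.mul_assoc B_wᵀ, ← Matrix.mul_add, ← hP]
    simp only [transpose_sub, transpose_mul, transpose_transpose]
  have hΓ : e ⬝ᵥ (Γᵀ * Γ).mulVec e = Γ.mulVec e ⬝ᵥ Γ.mulVec e := by
    rw [← mulVec_mulVec, dotProduct_mulVec, vecMul_transpose]
  have hneg := hM _ hv
  rw [dotProduct_fromBlocks_transpose_mulVec, hdiag, hoff, add_mulVec _ (Γᵀ * Γ),
    dotProduct_add, hΓ, neg_mulVec, smul_mulVec, one_mulVec, dotProduct_neg, dotProduct_smul,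
    smul_eq_mul] at hneg
  linarith
end

section
/- Let E, A, X, Γ be n×n real matrices with X symmetric, C a p×n real matrix, E⊥ and Y (n−r)×n real matrices, W an n×p real matrix, B_w an n×q real matrix, D_w a p×q real matrix, and γ > 0. Suppose P := X·E + E⊥ᵀ·Y is invertible with Eᵀ·P = Pᵀ·E, set L := (W·P⁻¹)ᵀ, and suppose the symmetric (n+q)×(n+q) block matrix [[Aᵀ·X·E + Eᵀ·X·A + Aᵀ·E⊥ᵀ·Y + Yᵀ·E⊥·A − Cᵀ·W − Wᵀ·C + Γᵀ·Γ, (B_wᵀ·X·E + B_wᵀ·E⊥ᵀ·Y − D_wᵀ·W)ᵀ],[B_wᵀ·X·E + B_wᵀ·E⊥ᵀ·Y − D_wᵀ·W, −γ·1]] is negative definite. Let e : ℝ → ℝⁿ be continuously differentiable and w : ℝ → ℝ^q continuous, with E·e'(t) = (A − L·C)·e(t) + (B_w − L·D_w)·w(t) for all t ≥ 0, e(0) = 0, e(t)ᵀ·(Eᵀ·P)·e(t) → 0 as t → ∞, and suppose t ↦ ‖Γ·e(t)‖² and t ↦ ‖w(t)‖² are integrable on (0, ∞). Then ∫_{(0,∞)}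 ‖Γ·e(t)‖² dt ≤ γ · ∫_{(0,∞)} ‖w(t)‖² dt. -/
open Matrix MeasureTheory Set Filter

/-- The quadratic form of a bounded-real-lemma block matrix. -/
lemma dotProduct_fromBlocks_boundedReal {n q : Type*} [Fintype n] [Fintype q] [DecidableEq q]
    (F P Γ : Matrix n n ℝ) (G : Matrix n q ℝ) (γ : ℝ) (x : n → ℝ) (u : q → ℝ) :
    Sum.elim x u ⬝ᵥ (fromBlocks (Fᵀ * P + Pᵀ * F + Γᵀ * Γ) (Gᵀ * P)ᵀ (Gᵀ * P)
        (-(γ • (1 : Matrix q q ℝ)))).mulVec (Sum.elim x u)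
      = 2 * ((F.mulVec x + G.mulVec u) ⬝ᵥ P.mulVec x)
        + Γ.mulVec x ⬝ᵥ Γ.mulVec x - γ * (u ⬝ᵥ u) := by
  have adj' : ∀ (a : n → ℝ) (b : q → ℝ),
      a ⬝ᵥ (Gᵀ * P)ᵀ.mulVec b = P.mulVec a ⬝ᵥ G.mulVec b := by
    intro a b
    rw [transpose_mul, transpose_transpose, ← mulVec_mulVec, dotProduct_mulVec,
      vecMul_transpose]
  rw [fromBlocks_mulVec, sumElim_dotProduct_sumElim]
  simp only [Sum.elim_comp_inl, Sum.elim_comp_inr, dotProduct_add, add_mulVec, adj',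
    ← mulVec_mulVec, neg_mulVec, smul_mulVec, one_mulVec, dotProduct_neg, dotProduct_smul,
    smul_eq_mul, add_dotProduct]
  have h1 : x ⬝ᵥ Fᵀ.mulVec (P.mulVec x) = F.mulVec x ⬝ᵥ P.mulVec x := by
    rw [dotProduct_mulVec, vecMul_transpose]
  have h2 : x ⬝ᵥ Pᵀ.mulVec (F.mulVec x) = F.mulVec x ⬝ᵥ P.mulVec x := by
    rw [dotProduct_mulVec, vecMul_transpose, dotProduct_comm]
  have h3 : x ⬝ᵥ Γᵀ.mulVec (Γ.mulVec x) = Γ.mulVec x ⬝ᵥ Γ.mulVec x := by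
    rw [dotProduct_mulVec, vecMul_transpose]
  have h4 : u ⬝ᵥ Gᵀ.mulVec (P.mulVec x) = G.mulVec u ⬝ᵥ P.mulVec x := by
    rw [dotProduct_mulVec, vecMul_transpose]
  rw [h1, h2, h3, h4, dotProduct_comm (P.mulVec x)]
  ring

lemma negDef.dotProduct_mulVec_nonpos {m : Type*} [Fintype m] {M : Matrix m m ℝ}
    (hM : negDef M) (v : m → ℝ) : v ⬝ᵥ M.mulVec v ≤ 0 := by
  by_cases hv : v = 0
  · simp [hv]
  · exact (hM v hv).le

lemma HasDerivAt.matrix_mulVec {m n : Type*} [Fintype m] [Fintype n] (M : Matrix m n ℝ)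
    {f : ℝ → n → ℝ} {f' : n → ℝ} {t : ℝ} (hf : HasDerivAt f f' t) :
    HasDerivAt (fun s => M.mulVec (f s)) (M.mulVec f') t :=
  (M.mulVecLin.toContinuousLinearMap.hasFDerivAt (x := f t)).comp_hasDerivAt t hf

lemma HasDerivAt.dotProduct {n : Type*} [Fintype n] {f g : ℝ → n → ℝ} {f' g' : n → ℝ} {t : ℝ}
    (hf : HasDerivAt f f' t) (hg : HasDerivAt g g' t) :
    HasDerivAt (fun s => f s ⬝ᵥ g s) (f' ⬝ᵥ g t + f t ⬝ᵥ g') t := by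
  rw [hasDerivAt_pi] at hf hg
  have := HasDerivAt.fun_sum (u := Finset.univ) fun i _ => (hf i).mul (hg i)
  simpa only [_root_.dotProduct, Pi.mul_apply, Finset.sum_add_distrib] using this

/-- Derivative of the generalized Lyapunov function `xᵀ Eᵀ P x` when `EᵀP` is symmetric. -/
lemma HasDerivAt.dotProduct_transpose_mul_mulVec {n : Type*} [Fintype n] {E P : Matrix n n ℝ}
    (hEP : Eᵀ * P = Pᵀ * E) {f : ℝ → n → ℝ} {f' : n → ℝ} {t : ℝ} (hf : HasDerivAt f f' t) :
    HasDerivAt (fun s => f s ⬝ᵥ (Eᵀ * P).mulVec (f s))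
      (2 * (E.mulVec f' ⬝ᵥ P.mulVec (f t))) t := by
  convert hf.dotProduct (hf.matrix_mulVec (Eᵀ * P)) using 1
  nth_rewrite 2 [hEP]
  simp only [← mulVec_mulVec, dotProduct_mulVec _ Eᵀ, dotProduct_mulVec _ Pᵀ, vecMul_transpose]
  rw [dotProduct_comm (P.mulVec (f t))]
  ring

/-- Dissipation inequality on a half-line: a storage function that starts and ends at zero
forces the integral of the supply bound to be nonpositive. -/
lemma setIntegral_Ioi_nonpos_of_deriv_add_le {V V' f : ℝ → ℝ}
    (hV : ∀ t, HasDerivAt V (V' t) t) (hV' : Continuous V') (hf : Continuous f)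
    (hle : ∀ t ≥ 0, V' t + f t ≤ 0) (hV0 : V 0 = 0) (hlim : Tendsto V atTop (nhds 0))
    (hint : IntegrableOn f (Ioi 0)) : ∫ t in Ioi (0 : ℝ), f t ≤ 0 := by
  have hT := intervalIntegral_tendsto_integral_Ioi 0 hint tendsto_id
  have hneg : Tendsto (fun t => -V t) atTop (nhds 0) := by simpa using hlim.neg
  refine le_of_tendsto_of_tendsto hT hneg ?_
  filter_upwards [eventually_ge_atTop 0] with T hT0
  have hFTC : ∫ t in (0 : ℝ)..T, V' t = V T - V 0 :=
    intervalIntegral.integral_eq_sub_of_hasDerivAt (fun t _ => hV t)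
      (hV'.intervalIntegrable _ _)
  calc ∫ t in (0 : ℝ)..T, f t ≤ ∫ t in (0 : ℝ)..T, -V' t :=
        intervalIntegral.integral_mono_on hT0 (hf.intervalIntegrable _ _)
          (hV'.neg.intervalIntegrable _ _) fun t ht => by linarith [hle t ht.1]
    _ = -V T := by rw [intervalIntegral.integral_neg, hFTC, hV0, sub_zero]

/-- Part (b) of Theorem 4 of the paper (H∞ performance of the robust DAE observer):
if the LMI (16) holds then, along the disturbed error dynamics
`E ė = (A - LC) e + (B_w - L D_w) w` with zero initial error and
`e(t)ᵀ EᵀP e(t) → 0`, the performance output `ε = Γ e` satisfies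
`∫ ‖Γ e‖² ≤ γ ∫ ‖w‖²` over `(0,∞)`. -/
theorem stmt_18 {n p q r : ℕ}
    (E A X Γ : Matrix (Fin n) (Fin n) ℝ) (hX : Xᵀ = X)
    (C : Matrix (Fin p) (Fin n) ℝ)
    (Eperp Y : Matrix (Fin (n - r)) (Fin n) ℝ)
    (W : Matrix (Fin p) (Fin n) ℝ)
    (B_w : Matrix (Fin n) (Fin q) ℝ)
    (D_w : Matrix (Fin p) (Fin q) ℝ)
    (γ : ℝ) (hγ : 0 < γ)
    (P : Matrix (Fin n) (Fin n) ℝ) (hP : P = X * E + Eperpᵀ * Y)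
    (hPinv : IsUnit P) (hEP : Eᵀ * P = Pᵀ * E)
    (L : Matrix (Fin n) (Fin p) ℝ) (hL : L = (W * P⁻¹)ᵀ)
    (hM : negDef (fromBlocks
        (Aᵀ * X * E + Eᵀ * X * A + Aᵀ * Eperpᵀ * Y + Yᵀ * Eperp * A
          - Cᵀ * W - Wᵀ * C + Γᵀ * Γ)
        (B_wᵀ * X * E + B_wᵀ * Eperpᵀ * Y - D_wᵀ * W)ᵀ
        (B_wᵀ * X * E + B_wᵀ * Eperpᵀ * Y - D_wᵀ * W)
        (-(γ • (1 : Matrix (Fin q) (Fin q) ℝ)))))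
    (e : ℝ → Fin n → ℝ) (w : ℝ → Fin q → ℝ)
    (he : ContDiff ℝ 1 e) (hw : Continuous w)
    (hdyn : ∀ t ≥ (0 : ℝ), E.mulVec (deriv e t)
      = (A - L * C).mulVec (e t) + (B_w - L * D_w).mulVec (w t))
    (he0 : e 0 = 0)
    (hlim : Tendsto (fun t => e t ⬝ᵥ ((Eᵀ * P).mulVec (e t))) atTop (nhds 0))
    (hint1 : IntegrableOn (fun t => (Γ.mulVec (e t)) ⬝ᵥ (Γ.mulVec (e t))) (Ioi 0))
    (hint2 : IntegrableOn (fun t => (w t) ⬝ᵥ (w t)) (Ioi 0)) :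
    (∫ t in Ioi (0 : ℝ), (Γ.mulVec (e t)) ⬝ᵥ (Γ.mulVec (e t)))
      ≤ γ * ∫ t in Ioi (0 : ℝ), (w t) ⬝ᵥ (w t) := by
  have hWP : Lᵀ * P = W := by
    rw [hL, transpose_transpose, Matrix.mul_assoc,
      nonsing_inv_mul P ((isUnit_iff_isUnit_det P).mp hPinv), Matrix.mul_one]
  have hWP' : Pᵀ * L = Wᵀ := by rw [← hWP, transpose_mul, transpose_transpose]
  have h11 : Aᵀ * X * E + Eᵀ * X * A + Aᵀ * Eperpᵀ * Y + Yᵀ * Eperp * A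
        - Cᵀ * W - Wᵀ * C + Γᵀ * Γ
      = (A - L * C)ᵀ * P + Pᵀ * (A - L * C) + Γᵀ * Γ := by
    have hl : (A - L * C)ᵀ * P = Aᵀ * P - Cᵀ * W := by
      rw [transpose_sub, transpose_mul, Matrix.sub_mul, Matrix.mul_assoc, hWP]
    have hr : Pᵀ * (A - L * C) = Pᵀ * A - Wᵀ * C := by
      rw [Matrix.mul_sub, ← Matrix.mul_assoc, hWP']
    rw [hl, hr, hP]
    simp only [transpose_add, transpose_mul, transpose_transpose, hX, Matrix.mul_add,
      Matrix.add_mul, Matrix.mul_assoc]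
    abel
  have h21 : B_wᵀ * X * E + B_wᵀ * Eperpᵀ * Y - D_wᵀ * W = (B_w - L * D_w)ᵀ * P := by
    rw [transpose_sub, transpose_mul, Matrix.sub_mul, Matrix.mul_assoc D_wᵀ, hWP, hP]
    simp only [Matrix.mul_add, Matrix.mul_assoc]
  rw [h11, h21] at hM
  have hderiv : ∀ t, HasDerivAt e (deriv e t) t := fun t =>
    (he.differentiable one_ne_zero t).hasDerivAt
  have he' : Continuous (deriv e) := he.continuous_deriv le_rfl
  have hec : Continuous e := he.continuous
  have hsupply := setIntegral_Ioi_nonpos_of_deriv_add_le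
    (f := fun t => Γ.mulVec (e t) ⬝ᵥ Γ.mulVec (e t) - γ * (w t ⬝ᵥ w t))
    (fun t => (hderiv t).dotProduct_transpose_mul_mulVec hEP)
    (by fun_prop) (by fun_prop)
    (fun t ht => by
      have h := hM.dotProduct_mulVec_nonpos (Sum.elim (e t) (w t))
      rw [dotProduct_fromBlocks_boundedReal, ← hdyn t ht] at h
      linarith)
    (by simp [he0]) hlim (hint1.sub (hint2.const_mul γ))
  rw [integral_sub hint1 (hint2.const_mul γ), integral_const_mul] at hsupply
  linarith
end
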